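/- Let (A_i)_{i∈ℕ} be a partition of ℕ such that for every n there exist at least n indices i with |A_i| ≥ n. Let Ω be the Kalton–Peck map and Ω̃ the chunked Kalton–Peck map associated to (A_i). Then there do NOT exist a constant K and a homogeneous map H : c00 → ℓ₂ such that ‖H(x+x') − H(x) − H(x') − Ω̃(Ω(x+x') − Ω(x) − Ω(x'))‖₂ ≤ K(‖x‖₂ + ‖x'‖₂) for all x, x' ∈ c00. (This is the concrete content of the fact that the concatenation Ω̃·Ω is a nontrivial element of Ext²(ℓ₂, ℓ₂).) -/

import Mathlib

/-- `x : ℕ → ℝ` is finitely supported (i.e. belongs to `c00`). -/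
def FinSupp (x : ℕ → ℝ) : Prop := (Function.support x).Finite

/-- The `ℓ₂` norm of a sequence, `‖x‖₂ = (∑ₙ |x n|²)^{1/2}`. -/
noncomputable def l2Norm (x : ℕ → ℝ) : ℝ := Real.sqrt (∑' n, (x n) ^ 2)

/-- The Kalton–Peck map `Ω : c00 → c00`,
`Ω(x)(n) = x n · log(‖x‖₂/|x n|)` when `x n ≠ 0` and `0` otherwise. -/
noncomputable def KP2 (x : ℕ → ℝ) : ℕ → ℝ :=
  fun n => if x n = 0 then 0 else x n * Real.log (l2Norm x / |x n|)

/-- A partition `(A_i)_{i∈ℕ}` of `ℕ` is encoded by the function `π : ℕ → ℕ` sending each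
`n ∈ ℕ` to the index of the member of the partition containing it, so `A_i = π⁻¹(i)`.
`chunk π i x` is the corresponding chunk `x_i = x·1_{A_i}` of a sequence `x`. -/
def chunk (π : ℕ → ℕ) (i : ℕ) (x : ℕ → ℝ) : ℕ → ℝ :=
  fun m => if π m = i then x m else 0

/-- The chunked Kalton–Peck map `Ω̃ : c00 → c00` associated to the partition encoded by
`π`: `Ω̃(x) = Σ_i x_i·log(‖x‖₂/‖x_i‖₂)`, the sum over those `i` with `x_i ≠ 0` (written
pointwise: its value at `n` is `x n · log(‖x‖₂/‖x_{π n}‖₂)` when `x n ≠ 0`, else `0`). -/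
noncomputable def KPchunk2 (π : ℕ → ℕ) (x : ℕ → ℝ) : ℕ → ℝ :=
  fun n => if x n = 0 then 0
    else x n * Real.log (l2Norm x / l2Norm (chunk π (π n) x))

/-- The partition encoded by `π` has, for every `n`, at least `n` members of cardinality
at least `n`. -/
def ManyLargeChunks (π : ℕ → ℕ) : Prop :=
  ∀ n : ℕ, ∃ T : Finset ℕ, n ≤ T.card ∧
    ∀ i ∈ T, ∃ F : Finset ℕ, n ≤ F.card ∧ ∀ m ∈ F, π m = i

/-- The vector supported on `S` whose values there are those of `σ`. -/
def restrictTo (σ : ℕ → ℝ) (S : Finset ℕ) : ℕ → ℝ :=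
  fun n => if n ∈ S then σ n else 0

/-- The sign pattern equal to `-1` exactly on `U`. -/
def signOf (U : Finset ℕ) : ℕ → ℝ := fun n => if n ∈ U then -1 else 1

lemma signOf_sq (U : Finset ℕ) (n : ℕ) : signOf U n ^ 2 = 1 := by
  unfold signOf; split_ifs <;> norm_num

lemma finSupp_restrictTo (σ : ℕ → ℝ) (S : Finset ℕ) : FinSupp (restrictTo σ S) :=
  S.finite_toSet.subset fun n hn => by
    by_contra h
    exact hn (if_neg h)

lemma l2Norm_eq_of_sq {x : ℕ → ℝ} {D : Finset ℕ} {c : ℝ}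
    (h1 : ∀ n ∈ D, x n ^ 2 = c ^ 2) (h0 : ∀ n ∉ D, x n = 0) :
    l2Norm x = |c| * √(D.card : ℝ) := by
  rw [l2Norm, tsum_eq_sum (s := D) (fun n hn => by simp [h0 n hn]), Finset.sum_congr rfl h1,
    Finset.sum_const, nsmul_eq_mul, mul_comm, Real.sqrt_mul (sq_nonneg c), Real.sqrt_sq_eq_abs]

lemma l2Norm_restrictTo {σ : ℕ → ℝ} (hσ : ∀ n, σ n ^ 2 = 1) (S : Finset ℕ) :
    l2Norm (restrictTo σ S) = √(S.card : ℝ) := by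
  rw [l2Norm_eq_of_sq (D := S) (c := 1)]
  · simp
  · intro n hn; simp [restrictTo, hn, hσ]
  · intro n hn; simp [restrictTo, hn]

lemma KP2_restrictTo {σ : ℕ → ℝ} (hσ : ∀ n, σ n ^ 2 = 1) (S : Finset ℕ) (n : ℕ) :
    KP2 (restrictTo σ S) n = restrictTo σ S n * (Real.log S.card / 2) := by
  by_cases hn : n ∈ S
  · have h0 : σ n ≠ 0 := fun h => by have := hσ n; simp [h] at this
    have h1 : |σ n| = 1 := by
      rw [← sq_eq_sq₀ (abs_nonneg _) zero_le_one, sq_abs, hσ, one_pow]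
    rw [KP2, l2Norm_restrictTo hσ]
    simp [restrictTo, hn, h0, h1, Real.log_sqrt]
  · simp [KP2, restrictTo, hn]

lemma restrictTo_union {σ : ℕ → ℝ} {S T : Finset ℕ} (h : Disjoint S T) :
    restrictTo σ (S ∪ T) = restrictTo σ S + restrictTo σ T := by
  funext n
  have hd : n ∈ S → n ∉ T := fun hn => Finset.disjoint_left.1 h hn
  by_cases h1 : n ∈ S <;> by_cases h2 : n ∈ T <;> simp_all [restrictTo]

lemma KP2_defect {σ : ℕ → ℝ} (hσ : ∀ n, σ n ^ 2 = 1) {S T : Finset ℕ} (h : Disjoint S T)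
    (hc : S.card = T.card) (hS : 0 < S.card) :
    KP2 (restrictTo σ S + restrictTo σ T) - KP2 (restrictTo σ S) - KP2 (restrictTo σ T)
      = fun n => Real.log 2 / 2 * restrictTo σ (S ∪ T) n := by
  funext n
  have hlog : Real.log ((S ∪ T).card : ℝ) = Real.log 2 + Real.log S.card := by
    rw [Finset.card_union_of_disjoint h, ← hc, ← two_mul, Nat.cast_mul, Nat.cast_ofNat,
      Real.log_mul two_ne_zero (by positivity)]
  rw [← restrictTo_union h]
  simp only [Pi.sub_apply]
  rw [KP2_restrictTo hσ, KP2_restrictTo hσ, KP2_restrictTo hσ, ← hc, hlog, restrictTo_union h,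
    Pi.add_apply]
  ring

lemma KPchunk2_restrictTo (π : ℕ → ℕ) {σ : ℕ → ℝ} (hσ : ∀ n, σ n ^ 2 = 1) {D : Finset ℕ}
    {m l : ℝ} (hl : l ≠ 0)
    (hD : ∀ n ∈ D, ((D.filter fun k => π k = π n).card : ℝ) * m = D.card) (n : ℕ) :
    KPchunk2 π (fun n => l * restrictTo σ D n) n
      = l * (Real.log m / 2) * restrictTo σ D n := by
  by_cases hn : n ∈ D
  · have h0 : σ n ≠ 0 := fun h => by have := hσ n; simp [h] at this
    have e1 : l2Norm (fun n => l * restrictTo σ D n) = |l| * √(D.card : ℝ) := by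
      apply l2Norm_eq_of_sq
      · intro k hk; simp [restrictTo, hk, mul_pow, hσ]
      · intro k hk; simp [restrictTo, hk]
    have e2 : l2Norm (chunk π (π n) fun n => l * restrictTo σ D n)
        = |l| * √((D.filter fun k => π k = π n).card : ℝ) := by
      apply l2Norm_eq_of_sq
      · intro k hk
        rw [Finset.mem_filter] at hk
        simp [restrictTo, chunk, hk, mul_pow, hσ]
      · intro k hk
        simp only [Finset.mem_filter, not_and] at hk
        by_cases hkD : k ∈ D
        · simp [chunk, hk hkD]
        · simp [chunk, restrictTo, hkD]
    have hpos : (0 : ℝ) < (D.filter fun k => π k = π n).card := by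
      exact_mod_cast Finset.card_pos.2 ⟨n, by simp [hn]⟩
    have hx : restrictTo σ D n = σ n := if_pos hn
    have hratio : |l| * √(D.card : ℝ) / (|l| * √((D.filter fun k => π k = π n).card : ℝ))
        = √m := by
      rw [mul_div_mul_left _ _ (abs_ne_zero.2 hl), ← hD n hn, Real.sqrt_mul hpos.le,
        mul_div_cancel_left₀ _ (Real.sqrt_pos.2 hpos).ne']
    have hm : 0 ≤ m := by
      by_contra hneg
      have := mul_neg_of_pos_of_neg hpos (not_le.1 hneg)
      rw [hD n hn] at this
      exact absurd this (not_lt.2 (Nat.cast_nonneg _))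
    rw [KPchunk2, if_neg (by rw [hx]; exact mul_ne_zero hl h0), e1, e2, hratio,
      Real.log_sqrt hm]
    ring
  · simp [KPchunk2, restrictTo, hn]

lemma abs_sum_mul_le_l2Norm (B : Finset ℕ) {f : ℕ → ℝ} (hf : Summable fun n => f n ^ 2)
    (g : ℕ → ℝ) : |∑ n ∈ B, f n * g n| ≤ l2Norm f * √(∑ n ∈ B, g n ^ 2) := by
  have h1 : √(∑ n ∈ B, f n ^ 2) ≤ l2Norm f :=
    Real.sqrt_le_sqrt (hf.sum_le_tsum B fun n _ => sq_nonneg _)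
  have h2 : |∑ n ∈ B, f n * g n| ≤ √(∑ n ∈ B, f n ^ 2) * √(∑ n ∈ B, g n ^ 2) := by
    rw [← Real.sqrt_mul (Finset.sum_nonneg fun n _ => sq_nonneg _)]
    exact Real.abs_le_sqrt (Finset.sum_mul_sq_le_sq_mul_sq B f g)
  exact h2.trans (mul_le_mul_of_nonneg_right h1 (Real.sqrt_nonneg _))

lemma summable_sq_sub {f g : ℕ → ℝ} (hf : Summable fun n => f n ^ 2)
    (hg : Summable fun n => g n ^ 2) : Summable fun n => (f n - g n) ^ 2 := by
  refine Summable.of_nonneg_of_le (fun n => sq_nonneg _) (fun n => ?_)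
    ((hf.mul_left 2).add (hg.mul_left 2))
  nlinarith [sq_nonneg (f n + g n)]

lemma sum_restrictTo_sq {σ : ℕ → ℝ} (hσ : ∀ n, σ n ^ 2 = 1) {B D : Finset ℕ} (h : D ⊆ B) :
    ∑ n ∈ B, restrictTo σ D n ^ 2 = D.card := by
  have : ∀ n, restrictTo σ D n ^ 2 = if n ∈ D then 1 else 0 := fun n => by
    by_cases hn : n ∈ D <;> simp [restrictTo, hn, hσ]
  simp [this, Finset.inter_eq_right.2 h]

/-- The hypotheses on `H` that the theorem refutes. -/
structure TrivializesChunkedKP (π : ℕ → ℕ) (K : ℝ) (H : (ℕ → ℝ) → (ℕ → ℝ)) : Prop where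
  summable : ∀ x, FinSupp x → Summable (fun n => (H x n) ^ 2)
  smul : ∀ (c : ℝ) (x : ℕ → ℝ), FinSupp x → H (c • x) = c • H x
  bound : ∀ x x' : ℕ → ℝ, FinSupp x → FinSupp x' →
    l2Norm (fun n => H (x + x') n - H x n - H x' n
        - KPchunk2 π (KP2 (x + x') - KP2 x - KP2 x') n)
      ≤ K * (l2Norm x + l2Norm x')

lemma abs_pairing_defect_le {π : ℕ → ℕ} {K : ℝ} {H : (ℕ → ℝ) → (ℕ → ℝ)}
    (hH : TrivializesChunkedKP π K H) {σ : ℕ → ℝ} (hσ : ∀ n, σ n ^ 2 = 1)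
    {B S T : Finset ℕ} (h : Disjoint S T) (hB : S ∪ T ⊆ B) (hc : S.card = T.card)
    (hS : 0 < S.card) {m : ℝ}
    (hD : ∀ n ∈ S ∪ T, (((S ∪ T).filter fun k => π k = π n).card : ℝ) * m = (S ∪ T).card) :
    |∑ n ∈ B, (H (restrictTo σ (S ∪ T)) n - H (restrictTo σ S) n - H (restrictTo σ T) n)
        * restrictTo σ (S ∪ T) n - Real.log 2 / 4 * Real.log m * (S ∪ T).card|
      ≤ 2 * |K| * (S ∪ T).card := by
  have hb := hH.bound _ _ (finSupp_restrictTo σ S) (finSupp_restrictTo σ T)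
  have hl : Real.log 2 / 2 ≠ 0 := (half_pos (Real.log_pos one_lt_two)).ne'
  simp only [KP2_defect hσ h hc hS, KPchunk2_restrictTo π hσ hl hD] at hb
  rw [← restrictTo_union h, l2Norm_restrictTo hσ, l2Norm_restrictTo hσ] at hb
  have hsum : Summable fun n => (H (restrictTo σ (S ∪ T)) n - H (restrictTo σ S) n
      - H (restrictTo σ T) n
      - Real.log 2 / 2 * (Real.log m / 2) * restrictTo σ (S ∪ T) n) ^ 2 := by
    refine summable_sq_sub (summable_sq_sub (summable_sq_sub ?_ ?_) ?_) ?_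
    · exact hH.summable _ (finSupp_restrictTo _ _)
    · exact hH.summable _ (finSupp_restrictTo _ _)
    · exact hH.summable _ (finSupp_restrictTo _ _)
    · refine summable_of_ne_finset_zero (s := S ∪ T) fun n hn => ?_
      simp only [restrictTo, if_neg hn]
      simp
  have hcs := abs_sum_mul_le_l2Norm B hsum (restrictTo σ (S ∪ T))
  rw [sum_restrictTo_sq hσ hB] at hcs
  have hsplit : ∑ n ∈ B, (H (restrictTo σ (S ∪ T)) n - H (restrictTo σ S) n
      - H (restrictTo σ T) n
      - Real.log 2 / 2 * (Real.log m / 2) * restrictTo σ (S ∪ T) n) * restrictTo σ (S ∪ T) n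
      = ∑ n ∈ B, (H (restrictTo σ (S ∪ T)) n - H (restrictTo σ S) n - H (restrictTo σ T) n)
        * restrictTo σ (S ∪ T) n - Real.log 2 / 4 * Real.log m * (S ∪ T).card := by
    rw [← sum_restrictTo_sq hσ hB, Finset.mul_sum, ← Finset.sum_sub_distrib]
    exact Finset.sum_congr rfl fun n _ => by ring
  rw [hsplit] at hcs
  have hST : √(S.card : ℝ) ≤ √((S ∪ T).card : ℝ) :=
    Real.sqrt_le_sqrt (by exact_mod_cast Finset.card_le_card Finset.subset_union_left)
  refine hcs.trans ((mul_le_mul_of_nonneg_right hb (Real.sqrt_nonneg _)).trans ?_)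
  have h3 : K * (√(S.card : ℝ) + √(T.card : ℝ)) ≤ |K| * (2 * √((S ∪ T).card : ℝ)) := by
    rw [← hc]
    exact mul_le_mul (le_abs_self K) (by linarith) (by positivity) (abs_nonneg K)
  calc _ ≤ |K| * (2 * √((S ∪ T).card : ℝ)) * √((S ∪ T).card : ℝ) :=
        mul_le_mul_of_nonneg_right h3 (Real.sqrt_nonneg _)
    _ = 2 * |K| * (√((S ∪ T).card : ℝ) * √((S ∪ T).card : ℝ)) := by ring
    _ = _ := by rw [Real.mul_self_sqrt (Nat.cast_nonneg _)]

/-- The average of `⟨H x, x⟩` over all sign vectors `x` supported on `S`, the signs ranging over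
patterns on `B ⊇ S`. -/
noncomputable def signAverage (H : (ℕ → ℝ) → (ℕ → ℝ)) (B S : Finset ℕ) : ℝ :=
  (∑ U ∈ B.powerset, ∑ n ∈ B, H (restrictTo (signOf U) S) n * restrictTo (signOf U) S n)
    / 2 ^ B.card

lemma sum_powerset_symmDiff {B T : Finset ℕ} (hT : T ⊆ B) (f : Finset ℕ → ℝ) :
    ∑ U ∈ B.powerset, f (symmDiff U T) = ∑ U ∈ B.powerset, f U := by
  have key : ∀ U ∈ B.powerset, symmDiff U T ∈ B.powerset := fun U hU => by
    rw [Finset.mem_powerset] at hU ⊢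
    intro n hn
    rcases Finset.mem_symmDiff.1 hn with h | h
    · exact hU h.1
    · exact hT h.1
  exact Finset.sum_nbij' (fun U => symmDiff U T) (fun U => symmDiff U T) key key
    (fun U _ => symmDiff_symmDiff_cancel_right T U)
    (fun U _ => symmDiff_symmDiff_cancel_right T U) fun _ _ => rfl

lemma restrictTo_signOf_symmDiff_self (U T : Finset ℕ) :
    restrictTo (signOf (symmDiff U T)) T = (-1 : ℝ) • restrictTo (signOf U) T := by
  funext n
  by_cases h : n ∈ T <;> by_cases hU : n ∈ U <;>
    simp [restrictTo, signOf, Finset.mem_symmDiff, h, hU]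

lemma restrictTo_signOf_symmDiff_of_disjoint (U : Finset ℕ) {S T : Finset ℕ}
    (h : Disjoint S T) :
    restrictTo (signOf (symmDiff U T)) S = restrictTo (signOf U) S := by
  funext n
  have hd : n ∈ S → n ∉ T := fun hn => Finset.disjoint_left.1 h hn
  by_cases hS : n ∈ S
  · have hT := hd hS
    simp [restrictTo, signOf, Finset.mem_symmDiff, hS, hT]
  · simp [restrictTo, hS]

lemma abs_signAverage_defect_le {π : ℕ → ℕ} {K : ℝ} {H : (ℕ → ℝ) → (ℕ → ℝ)}
    (hH : TrivializesChunkedKP π K H)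
    {B S T : Finset ℕ} (h : Disjoint S T) (hB : S ∪ T ⊆ B) (hc : S.card = T.card)
    (hS : 0 < S.card) {m : ℝ}
    (hD : ∀ n ∈ S ∪ T, (((S ∪ T).filter fun k => π k = π n).card : ℝ) * m = (S ∪ T).card) :
    |signAverage H B (S ∪ T) - signAverage H B S - signAverage H B T
        - Real.log 2 / 4 * Real.log m * (S ∪ T).card|
      ≤ 2 * |K| * (S ∪ T).card := by
  set C := Real.log 2 / 4 * Real.log m * (S ∪ T).card
  set E := 2 * |K| * ((S ∪ T).card : ℝ)
  set F : Finset ℕ → Finset ℕ → ℝ := fun D U =>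
    ∑ n ∈ B, H (restrictTo (signOf U) D) n * restrictTo (signOf U) D n with hF
  have hpt : ∀ U, |(F (S ∪ T) U + F (S ∪ T) (symmDiff U T)) - 2 * F S U - 2 * F T U - 2 * C|
      ≤ 2 * E := fun U => by
    have a1 := abs_pairing_defect_le hH (signOf_sq U) h hB hc hS hD
    have a2 := abs_pairing_defect_le hH (signOf_sq (symmDiff U T)) h hB hc hS hD
    have hid : (F (S ∪ T) U + F (S ∪ T) (symmDiff U T)) - 2 * F S U - 2 * F T U
        = ∑ n ∈ B, (H (restrictTo (signOf U) (S ∪ T)) n - H (restrictTo (signOf U) S) n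
            - H (restrictTo (signOf U) T) n) * restrictTo (signOf U) (S ∪ T) n
          + ∑ n ∈ B, (H (restrictTo (signOf (symmDiff U T)) (S ∪ T)) n
            - H (restrictTo (signOf (symmDiff U T)) S) n
            - H (restrictTo (signOf (symmDiff U T)) T) n)
              * restrictTo (signOf (symmDiff U T)) (S ∪ T) n := by
      simp only [hF]
      rw [Finset.mul_sum, Finset.mul_sum, ← Finset.sum_add_distrib, ← Finset.sum_sub_distrib,
        ← Finset.sum_sub_distrib, ← Finset.sum_add_distrib]
      refine Finset.sum_congr rfl fun n _ => ?_
      have e1 : restrictTo (signOf U) (S ∪ T) n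
          = restrictTo (signOf U) S n + restrictTo (signOf U) T n := by
        rw [restrictTo_union h, Pi.add_apply]
      have e2 : restrictTo (signOf (symmDiff U T)) (S ∪ T) n
          = restrictTo (signOf U) S n - restrictTo (signOf U) T n := by
        rw [restrictTo_union h, Pi.add_apply, restrictTo_signOf_symmDiff_self,
          restrictTo_signOf_symmDiff_of_disjoint U h, Pi.smul_apply, smul_eq_mul]
        ring
      have e3 : H (restrictTo (signOf (symmDiff U T)) T) n = - H (restrictTo (signOf U) T) n := by
        rw [restrictTo_signOf_symmDiff_self, hH.smul _ _ (finSupp_restrictTo _ _),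
          Pi.smul_apply, smul_eq_mul]
        ring
      rw [e3, e2, e1, restrictTo_signOf_symmDiff_of_disjoint U h]
      ring
    rw [hid]
    change |_ - C| ≤ E at a1 a2
    rw [abs_le] at a1 a2 ⊢
    constructor <;> linarith [a1.1, a1.2, a2.1, a2.2]
  have hsum : |∑ U ∈ B.powerset,
      ((F (S ∪ T) U + F (S ∪ T) (symmDiff U T)) - 2 * F S U - 2 * F T U - 2 * C)|
      ≤ 2 ^ B.card * (2 * E) := by
    refine (Finset.abs_sum_le_sum_abs _ _).trans ((Finset.sum_le_sum fun U _ => hpt U).trans ?_)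
    simp [Finset.card_powerset]
  have hTB : T ⊆ B := Finset.subset_union_right.trans hB
  rw [Finset.sum_sub_distrib, Finset.sum_sub_distrib, Finset.sum_sub_distrib,
    Finset.sum_add_distrib, sum_powerset_symmDiff hTB (F (S ∪ T)), ← Finset.mul_sum,
    ← Finset.mul_sum, Finset.sum_const, Finset.card_powerset, nsmul_eq_mul] at hsum
  push_cast at hsum
  have hP : (0 : ℝ) < 2 ^ B.card := by positivity
  have hav : ∀ D, ∑ U ∈ B.powerset, F D U = 2 ^ B.card * signAverage H B D := fun D => by
    rw [signAverage, mul_div_cancel₀ _ hP.ne']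
  rw [hav, hav, hav] at hsum
  have : 2 ^ B.card * signAverage H B (S ∪ T) + 2 ^ B.card * signAverage H B (S ∪ T)
      - 2 * (2 ^ B.card * signAverage H B S) - 2 * (2 ^ B.card * signAverage H B T)
      - 2 ^ B.card * (2 * C) = 2 ^ B.card * (2 * (signAverage H B (S ∪ T) - signAverage H B S
        - signAverage H B T - C)) := by ring
  rw [this, abs_mul, abs_of_pos hP, abs_mul, abs_two] at hsum
  have := le_of_mul_le_mul_left hsum hP
  linarith

lemma abs_sub_sum_singleton_le_of_halving {u : Finset ℕ → ℝ} {α : ℕ → ℝ} {L : ℝ} {n : ℕ}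
    {V : Finset ℕ}
    (h : ∀ b < n, ∀ I J : Finset ℕ, I ∪ J ⊆ V → Disjoint I J → I.card = 2 ^ b →
      J.card = 2 ^ b →
      |u (I ∪ J) - u I - u J - α (b + 1) * 2 ^ (b + 1)| ≤ L * 2 ^ (b + 1)) :
    ∀ b ≤ n, ∀ I ⊆ V, I.card = 2 ^ b →
      |u I - ∑ i ∈ I, u {i} - 2 ^ b * ∑ j ∈ Finset.range b, α (j + 1)| ≤ L * b * 2 ^ b := by
  intro b
  induction b with
  | zero =>
    intro _ I _ hI
    obtain ⟨i, rfl⟩ := Finset.card_eq_one.1 (by simpa using hI)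
    simp
  | succ b ih =>
    intro hb I hIV hI
    obtain ⟨I₁, hI₁, hc₁⟩ := Finset.exists_subset_card_eq (s := I) (n := 2 ^ b)
      (by rw [hI]; exact Nat.pow_le_pow_right two_pos b.le_succ)
    have hc₂ : (I \ I₁).card = 2 ^ b := by
      rw [Finset.card_sdiff_of_subset hI₁, hI, hc₁, pow_succ]; omega
    have hd : Disjoint I₁ (I \ I₁) := Finset.disjoint_sdiff
    have hu : I₁ ∪ I \ I₁ = I := Finset.union_sdiff_of_subset hI₁
    have k := h b (by omega) I₁ (I \ I₁) (by rwa [hu]) hd hc₁ hc₂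
    have k₁ := ih (by omega) I₁ (hI₁.trans hIV) hc₁
    have k₂ := ih (by omega) (I \ I₁) (Finset.sdiff_subset.trans hIV) hc₂
    have hs : ∑ i ∈ I, u {i} = ∑ i ∈ I₁, u {i} + ∑ i ∈ I \ I₁, u {i} := by
      rw [← Finset.sum_union hd, hu]
    rw [hu] at k
    rw [hs, Finset.sum_range_succ]
    rw [abs_le] at k k₁ k₂ ⊢
    push_cast
    rw [pow_succ] at k ⊢
    constructor <;> linarith [k.1, k.2, k₁.1, k₁.2, k₂.1, k₂.2]

/-- The combinatorial core: a function of rectangles whose halving defects are those of a rectangle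
function additive up to a logarithm of the width gives two incompatible evaluations. -/
lemma mul_le_of_rectangle_halving {g : Finset ℕ → Finset ℕ → ℝ} {c L : ℝ} {n : ℕ}
    {V W : Finset ℕ} (hV : V.card = 2 ^ n) (hW : W.card = 2 ^ n)
    (hrow : ∀ b < n, ∀ a ≤ n, ∀ I I' J : Finset ℕ, I ∪ I' ⊆ V → J ⊆ W → Disjoint I I' →
      I.card = 2 ^ b → I'.card = 2 ^ b → J.card = 2 ^ a →
      |g (I ∪ I') J - g I J - g I' J - c * (b + 1 : ℕ) * (2 ^ (b + 1) * 2 ^ a)|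
        ≤ L * (2 ^ (b + 1) * 2 ^ a))
    (hcol : ∀ b ≤ n, ∀ a < n, ∀ I J J' : Finset ℕ, I ⊆ V → J ∪ J' ⊆ W → Disjoint J J' →
      I.card = 2 ^ b → J.card = 2 ^ a → J'.card = 2 ^ a →
      |g I (J ∪ J') - g I J - g I J' - c * (b : ℕ) * (2 ^ b * 2 ^ (a + 1))|
        ≤ L * (2 ^ b * 2 ^ (a + 1))) :
    c * n * n ≤ 4 * L * n := by
  have row : ∀ a ≤ n, ∀ J ⊆ W, J.card = 2 ^ a →
      |g V J - ∑ i ∈ V, g {i} J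
          - 2 ^ n * ∑ j ∈ Finset.range n, c * (j + 1 : ℕ) * 2 ^ a| ≤ L * 2 ^ a * n * 2 ^ n := by
    intro a ha J hJW hJ
    refine abs_sub_sum_singleton_le_of_halving (u := fun I => g I J)
      (α := fun j => c * j * 2 ^ a) (n := n) (V := V) ?_ n le_rfl V subset_rfl hV
    intro b hb I I' hI hd h1 h2
    have := hrow b hb a ha I I' J hI hJW hd h1 h2 hJ
    convert this using 1
    · congr 1; ring
    · ring
  have col : ∀ b ≤ n, ∀ I ⊆ V, I.card = 2 ^ b →
      |g I W - ∑ j ∈ W, g I {j}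
          - 2 ^ n * ∑ j ∈ Finset.range n, c * (b : ℕ) * 2 ^ b| ≤ L * 2 ^ b * n * 2 ^ n := by
    intro b hb I hIV hI
    refine abs_sub_sum_singleton_le_of_halving (u := fun J => g I J)
      (α := fun _ => c * b * 2 ^ b) (n := n) (V := W) ?_ n le_rfl W subset_rfl hW
    intro a ha J J' hJ hd h1 h2
    have := hcol b hb a ha I J J' hIV hJ hd hI h1 h2
    convert this using 1
    · congr 1; ring
    · ring
  have r1 := row n le_rfl W subset_rfl hW
  have c1 := col n le_rfl V subset_rfl hV
  have r2 : |∑ j ∈ W, (g V {j} - ∑ i ∈ V, g {i} {j}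
      - 2 ^ n * ∑ j ∈ Finset.range n, c * (j + 1 : ℕ) * 2 ^ 0)|
      ≤ 2 ^ n * (L * 2 ^ 0 * n * 2 ^ n) := by
    refine (Finset.abs_sum_le_sum_abs _ _).trans ((Finset.sum_le_sum fun j hj =>
      row 0 (Nat.zero_le n) {j} (by simpa using hj) (by simp)).trans ?_)
    simp [hW]
  have c2 : |∑ i ∈ V, (g {i} W - ∑ j ∈ W, g {i} {j}
      - 2 ^ n * ∑ j ∈ Finset.range n, c * (0 : ℕ) * 2 ^ 0)|
      ≤ 2 ^ n * (L * 2 ^ 0 * n * 2 ^ n) := by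
    refine (Finset.abs_sum_le_sum_abs _ _).trans ((Finset.sum_le_sum fun i hi =>
      col 0 (Nat.zero_le n) {i} (by simpa using hi) (by simp)).trans ?_)
    simp [hV]
  simp only [Finset.sum_sub_distrib, Finset.sum_const, hW, nsmul_eq_mul, Nat.cast_zero,
    mul_zero, Finset.card_range, ← Finset.sum_mul, pow_zero, mul_one, sub_zero]
    at r1 c1 r2 c2
  rw [Finset.sum_comm] at r2
  push_cast at r1 c1 r2 c2
  rw [abs_le] at r1 c1 r2 c2
  have hP : (0 : ℝ) < 2 ^ n * 2 ^ n := by positivity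
  refine le_of_mul_le_mul_left ?_ hP
  linarith [r1.1, r1.2, c1.1, c1.2, r2.1, r2.2, c2.1, c2.2]

lemma exists_grid_of_manyLargeChunks {π : ℕ → ℕ} (hπ : ManyLargeChunks π) (N : ℕ) :
    ∃ (V : Finset ℕ) (e : ℕ → ℕ → ℕ), V.card = N ∧
      (∀ i ∈ V, ∀ j ∈ Finset.range N, π (e i j) = i) ∧
      ∀ i ∈ V, Set.InjOn (e i) (Finset.range N) := by
  obtain ⟨T, hT, hF⟩ := hπ N
  obtain ⟨V, hVT, hV⟩ := Finset.exists_subset_card_eq hT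
  have hrow : ∀ i, ∃ f : ℕ → ℕ, i ∈ V →
      (∀ j ∈ Finset.range N, π (f j) = i) ∧ Set.InjOn f (Finset.range N) := fun i => by
    by_cases hi : i ∈ V
    · obtain ⟨F, hFN, hFi⟩ := hF i (hVT hi)
      obtain ⟨f, hf, hinj⟩ := (Finset.range N).finite_toSet.exists_injOn_of_encard_le
        (t := (F : Set ℕ)) (by
          rw [Set.encard_coe_eq_coe_finsetCard, Set.encard_coe_eq_coe_finsetCard,
            Finset.card_range]
          exact_mod_cast hFN)
      exact ⟨f, fun _ => ⟨fun j hj => hFi _ (hf hj), hinj⟩⟩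
    · exact ⟨id, fun h => absurd h hi⟩
  choose e he using hrow
  exact ⟨V, e, hV, fun i hi => (he i hi).1, fun i hi => (he i hi).2⟩

/-- The image under `e` of the rectangle `I × J`. -/
def gridRect (e : ℕ → ℕ → ℕ) (I J : Finset ℕ) : Finset ℕ :=
  (I ×ˢ J).image fun p => e p.1 p.2

section Grid

variable {π : ℕ → ℕ} {V W : Finset ℕ} {e : ℕ → ℕ → ℕ}

lemma gridRect_injOn (he : ∀ i ∈ V, ∀ j ∈ W, π (e i j) = i)
    (hinj : ∀ i ∈ V, Set.InjOn (e i) W) :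
    Set.InjOn (fun p : ℕ × ℕ => e p.1 p.2) (V ×ˢ W : Finset (ℕ × ℕ)) := by
  rintro ⟨i, j⟩ h ⟨i', j'⟩ h' heq
  simp only [Finset.coe_product, Set.mem_prod, Finset.mem_coe] at h h' heq
  have hi : i = i' := by rw [← he i h.1 j h.2, ← he i' h'.1 j' h'.2, heq]
  subst hi
  exact Prod.ext rfl (hinj i h.1 h.2 h'.2 heq)

lemma card_gridRect (he : ∀ i ∈ V, ∀ j ∈ W, π (e i j) = i)
    (hinj : ∀ i ∈ V, Set.InjOn (e i) W) {I J : Finset ℕ} (hI : I ⊆ V) (hJ : J ⊆ W) :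
    (gridRect e I J).card = I.card * J.card := by
  rw [gridRect, Finset.card_image_of_injOn, Finset.card_product]
  exact (gridRect_injOn he hinj).mono (by exact_mod_cast Finset.product_subset_product hI hJ)

lemma gridRect_filter (he : ∀ i ∈ V, ∀ j ∈ W, π (e i j) = i) {I J : Finset ℕ}
    (hI : I ⊆ V) (hJ : J ⊆ W) {i : ℕ} (hi : i ∈ I) :
    (gridRect e I J).filter (fun k => π k = i) = gridRect e {i} J := by
  ext k
  simp only [gridRect, Finset.mem_filter, Finset.mem_image, Finset.mem_product, Prod.exists,
    Finset.mem_singleton]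
  constructor
  · rintro ⟨⟨i', j, ⟨hi', hj⟩, rfl⟩, h⟩
    rw [he i' (hI hi') j (hJ hj)] at h
    exact ⟨i', j, ⟨h, hj⟩, rfl⟩
  · rintro ⟨i', j, ⟨rfl, hj⟩, rfl⟩
    exact ⟨⟨i', j, ⟨hi, hj⟩, rfl⟩, he i' (hI hi) j (hJ hj)⟩

lemma card_gridRect_filter (he : ∀ i ∈ V, ∀ j ∈ W, π (e i j) = i)
    (hinj : ∀ i ∈ V, Set.InjOn (e i) W) {I J : Finset ℕ} (hI : I ⊆ V) (hJ : J ⊆ W) :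
    ∀ n ∈ gridRect e I J, (((gridRect e I J).filter fun k => π k = π n).card : ℝ) * I.card
      = (gridRect e I J).card := by
  intro n hn
  obtain ⟨⟨i, j⟩, hp, rfl⟩ := Finset.mem_image.1 hn
  rw [Finset.mem_product] at hp
  rw [he i (hI hp.1) j (hJ hp.2), gridRect_filter he hI hJ hp.1, card_gridRect he hinj hI hJ,
    card_gridRect he hinj (by simpa using hI hp.1) hJ]
  push_cast [Finset.card_singleton]
  ring

lemma abs_signAverage_gridRect_defect_le {K : ℝ} {H : (ℕ → ℝ) → (ℕ → ℝ)}
    (hH : TrivializesChunkedKP π K H) (he : ∀ i ∈ V, ∀ j ∈ W, π (e i j) = i)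
    (hinj : ∀ i ∈ V, Set.InjOn (e i) W) {I J I₁ J₁ I₂ J₂ : Finset ℕ} (hI : I ⊆ V) (hJ : J ⊆ W)
    (hprod : I ×ˢ J = I₁ ×ˢ J₁ ∪ I₂ ×ˢ J₂) (hd : Disjoint (I₁ ×ˢ J₁) (I₂ ×ˢ J₂))
    (hc : (I₁ ×ˢ J₁).card = (I₂ ×ˢ J₂).card) (h0 : 0 < (I₁ ×ˢ J₁).card) :
    |signAverage H (gridRect e V W) (gridRect e I J)
        - signAverage H (gridRect e V W) (gridRect e I₁ J₁)
        - signAverage H (gridRect e V W) (gridRect e I₂ J₂)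
        - Real.log 2 / 4 * Real.log I.card * (I.card * J.card)|
      ≤ 2 * |K| * (I.card * J.card) := by
  have hIJ : I ×ˢ J ⊆ V ×ˢ W := Finset.product_subset_product hI hJ
  have inj := gridRect_injOn he hinj
  have s₁ : I₁ ×ˢ J₁ ⊆ V ×ˢ W := (hprod ▸ Finset.subset_union_left).trans hIJ
  have s₂ : I₂ ×ˢ J₂ ⊆ V ×ˢ W := (hprod ▸ Finset.subset_union_right).trans hIJ
  have hun : gridRect e I J = gridRect e I₁ J₁ ∪ gridRect e I₂ J₂ := by
    rw [gridRect, hprod, Finset.image_union, gridRect, gridRect]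
  have c₁ : (gridRect e I₁ J₁).card = (I₁ ×ˢ J₁).card :=
    Finset.card_image_of_injOn (inj.mono (by exact_mod_cast s₁))
  have c₂ : (gridRect e I₂ J₂).card = (I₂ ×ˢ J₂).card :=
    Finset.card_image_of_injOn (inj.mono (by exact_mod_cast s₂))
  have hdis : Disjoint (gridRect e I₁ J₁) (gridRect e I₂ J₂) := by
    rw [Finset.disjoint_left]
    intro k hk₁ hk₂
    obtain ⟨p, hp, rfl⟩ := Finset.mem_image.1 hk₁
    obtain ⟨q, hq, hqp⟩ := Finset.mem_image.1 hk₂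
    have : q = p := inj (s₂ hq) (s₁ hp) hqp
    exact Finset.disjoint_left.1 hd hp (this ▸ hq)
  have hfib := card_gridRect_filter he hinj hI hJ
  have hcard : ((gridRect e I J).card : ℝ) = I.card * J.card := by
    rw [card_gridRect he hinj hI hJ, Nat.cast_mul]
  have hsub : gridRect e I J ⊆ gridRect e V W := Finset.image_subset_image hIJ
  rw [← hcard]
  rw [hun] at hfib hsub ⊢
  exact abs_signAverage_defect_le hH hdis hsub (by rw [c₁, c₂, hc]) (by rwa [c₁]) hfib

end Grid

/-- Let `(A_i)` be a partition of `ℕ` such that for every `n` there are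
at least `n` indices `i` with `|A_i| ≥ n`; let `Ω` be the Kalton–Peck map and `Ω̃` the
chunked Kalton–Peck map associated to `(A_i)`. Then there are NO constant `K` and
homogeneous map `H : c00 → ℓ₂` such that
`‖H(x+x') − H(x) − H(x') − Ω̃(Ω(x+x') − Ω(x) − Ω(x'))‖₂ ≤ K(‖x‖₂ + ‖x'‖₂)` for all
`x, x' ∈ c00`. (The concatenation `Ω̃·Ω` is a nontrivial element of `Ext²(ℓ₂, ℓ₂)`.) -/
theorem chunkedKP_KP_nontrivial_in_Ext2 (π : ℕ → ℕ) (hπ : ManyLargeChunks π) :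
    ¬ ∃ (K : ℝ) (H : (ℕ → ℝ) → (ℕ → ℝ)),
        (∀ x, FinSupp x → Summable (fun n => (H x n) ^ 2)) ∧
        (∀ (c : ℝ) (x : ℕ → ℝ), FinSupp x → H (c • x) = c • H x) ∧
        (∀ x x' : ℕ → ℝ, FinSupp x → FinSupp x' →
          l2Norm (fun n => H (x + x') n - H x n - H x' n
              - KPchunk2 π (KP2 (x + x') - KP2 x - KP2 x') n)
            ≤ K * (l2Norm x + l2Norm x')) := by
  rintro ⟨K, H, hsum, hsmul, hbound⟩
  have hH : TrivializesChunkedKP π K H := ⟨hsum, hsmul, hbound⟩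
  have hlog : 0 < Real.log 2 := Real.log_pos one_lt_two
  set c := Real.log 2 / 4 * Real.log 2 with hcdef
  have hc : 0 < c := by positivity
  obtain ⟨n, hn⟩ := exists_nat_gt (4 * (2 * |K|) / c)
  have hn0 : (0 : ℝ) < n := lt_of_le_of_lt (by positivity) hn
  obtain ⟨V, e, hV, he, hinj⟩ := exists_grid_of_manyLargeChunks hπ (2 ^ n)
  set W := Finset.range (2 ^ n) with hWdef
  have key : c * n * n ≤ 4 * (2 * |K|) * n := by
    refine mul_le_of_rectangle_halving
      (g := fun I J => signAverage H (gridRect e V W) (gridRect e I J)) hV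
      (Finset.card_range _) ?_ ?_
    · intro b _ a _ I I' J hI hJ hd h1 h2 h3
      have hu : (I ∪ I').card = 2 ^ (b + 1) := by
        rw [Finset.card_union_of_disjoint hd, h1, h2, pow_succ]; ring
      have := abs_signAverage_gridRect_defect_le hH he hinj hI hJ
        (Finset.union_product) (Finset.disjoint_product.2 (Or.inl hd))
        (by simp [h1, h2]) (by simp [h1, h3])
      rw [hu, h3] at this
      push_cast at this ⊢
      rw [Real.log_pow] at this
      convert this using 2
      rw [hcdef]; push_cast; ring
    · intro b _ a _ I J J' hI hJ hd h1 h2 h3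
      have hu : (J ∪ J').card = 2 ^ (a + 1) := by
        rw [Finset.card_union_of_disjoint hd, h2, h3, pow_succ]; ring
      have := abs_signAverage_gridRect_defect_le hH he hinj hI hJ
        (Finset.product_union ..) (Finset.disjoint_product.2 (Or.inr hd))
        (by simp [h2, h3]) (by simp [h1, h2])
      rw [hu, h1] at this
      push_cast at this ⊢
      rw [Real.log_pow] at this
      convert this using 2
      rw [hcdef]; ring
  rw [div_lt_iff₀ hc] at hn
  have := le_of_mul_le_mul_right key hn0
  linarith
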